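/- Let G be a graph (self-loops allowed, no parallel edges), let 𝒯 be a subset of the triangles of G, and let A₁, A₂ be two 𝒯-free 2-matchings of G. Let u₁, u₂, u₃, u₄ be four distinct nodes such that T = {u₁u₂, u₂u₃, u₁u₃} ∈ 𝒯 and T' = {u₂u₄, u₂u₃, u₃u₄} ∈ 𝒯, with {u₁u₂, u₁u₃, u₂u₄, u₃u₄} ⊆ A₁\A₂ and u₂u₃ ∈ A₂\A₁. Assume moreover that every triangle of 𝒯 is contained in A₁ ∪ A₂, and that there is no triangle T'' ∈ 𝒯 with |A₂ ∩ T''| = 2 such that A₂ΔT'' is 𝒯-free. Then every triangle in 𝒯(T ∪ T') has its node set contained in {u₁, u₂, u₃, u₄}. -/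

import Mathlib

open Finset

variable {V : Type*}

/-- Degree of a vertex w.r.t. an edge set, self-loops counted twice. -/
def sym2Deg [DecidableEq V] (F : Finset (Sym2 V)) (v : V) : ℕ :=
  ∑ e ∈ F, (if e = s(v, v) then 2 else if v ∈ e then 1 else 0)

def IsTwoMatching [DecidableEq V] (F : Finset (Sym2 V)) : Prop :=
  ∀ v : V, sym2Deg F v ≤ 2

def IsTriangle [DecidableEq V] (T : Finset (Sym2 V)) : Prop :=
  ∃ a b c : V, a ≠ b ∧ a ≠ c ∧ b ≠ c ∧ T = {s(a, b), s(b, c), s(a, c)}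

def TriangleFree [DecidableEq V] (F : Finset (Sym2 V)) : Prop :=
  ∀ T : Finset (Sym2 V), IsTriangle T → ¬ T ⊆ F

def TFree [DecidableEq V] (𝒯 : Finset (Finset (Sym2 V))) (F : Finset (Sym2 V)) : Prop :=
  ∀ T ∈ 𝒯, ¬ T ⊆ F

def wSum (w : Sym2 V → ℚ) (F : Finset (Sym2 V)) : ℚ := ∑ e ∈ F, w e

/-- A trail of length `k` in an edge set `E`: a sequence of distinct consecutive edges. -/
def IsTrail [DecidableEq V] (E : Finset (Sym2 V)) (k : ℕ) (u : ℕ → V) : Prop :=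
  (∀ i < k, s(u i, u (i + 1)) ∈ E) ∧
  (∀ i < k, ∀ j < k, s(u i, u (i + 1)) = s(u j, u (j + 1)) → i = j)

def trailEdges [DecidableEq V] (k : ℕ) (u : ℕ → V) : Finset (Sym2 V) :=
  (Finset.range k).image (fun i => s(u i, u (i + 1)))

def trailSl [DecidableEq V] (k : ℕ) (u : ℕ → V) : ℕ :=
  ((Finset.range k).filter (fun i => u i = u (i + 1))).card

def IsAltTrail [DecidableEq V] (A₁ A₂ : Finset (Sym2 V)) (k : ℕ) (u : ℕ → V) : Prop :=
  IsTrail (symmDiff A₁ A₂) k u ∧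
  ∀ i, i + 1 < k →
    (s(u i, u (i + 1)) ∈ A₁ \ A₂ ↔ s(u (i + 1), u (i + 2)) ∈ A₂ \ A₁)

/-- A node of a 2-matching has at most two neighbours. -/
lemma IsTwoMatching.not_three_neighbours [DecidableEq V] {F : Finset (Sym2 V)}
    (hF : IsTwoMatching F) {v a b c : V} (ha : s(v, a) ∈ F) (hb : s(v, b) ∈ F)
    (hc : s(v, c) ∈ F) (hab : a ≠ b) (hac : a ≠ c) (hbc : b ≠ c) : False := by
  have hsub : ({s(v, a), s(v, b), s(v, c)} : Finset (Sym2 V)) ⊆ F := by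
    simp [Finset.insert_subset_iff, ha, hb, hc]
  have hcard : ({s(v, a), s(v, b), s(v, c)} : Finset (Sym2 V)).card = 3 :=
    Finset.card_eq_three.2 ⟨_, _, _, mt Sym2.congr_right.1 hab, mt Sym2.congr_right.1 hac,
      mt Sym2.congr_right.1 hbc, rfl⟩
  have hle : ({s(v, a), s(v, b), s(v, c)} : Finset (Sym2 V)).card ≤ sym2Deg F v := by
    rw [sym2Deg, Finset.card_eq_sum_ones]
    refine le_trans (Finset.sum_le_sum fun e he => ?_)
      (Finset.sum_le_sum_of_subset hsub)
    have hv : v ∈ e := by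
      simp only [Finset.mem_insert, Finset.mem_singleton] at he
      rcases he with rfl | rfl | rfl <;> exact Sym2.mem_mk_left _ _
    split_ifs <;> simp
  have := hF v
  omega

/-- A triangle through the edge `pq` consists of `p`, `q` and a third node. -/
lemma IsTriangle.exists_third [DecidableEq V] {T : Finset (Sym2 V)} (hT : IsTriangle T)
    {p q : V} (h : s(p, q) ∈ T) :
    ∃ x, x ≠ p ∧ x ≠ q ∧ T = {s(p, q), s(p, x), s(q, x)} := by
  obtain ⟨a, b, c, hab, hac, hbc, rfl⟩ := hT
  simp only [Finset.mem_insert, Finset.mem_singleton, Sym2.eq_iff] at h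
  rcases h with (⟨rfl, rfl⟩ | ⟨rfl, rfl⟩) | (⟨rfl, rfl⟩ | ⟨rfl, rfl⟩) | ⟨rfl, rfl⟩ | ⟨rfl, rfl⟩
  · exact ⟨c, hac.symm, hbc.symm, by grind⟩
  · exact ⟨c, hbc.symm, hac.symm, by grind [Sym2.eq_swap]⟩
  · exact ⟨a, hab, hac, by grind [Sym2.eq_swap]⟩
  · exact ⟨a, hac, hab, by grind [Sym2.eq_swap]⟩
  · exact ⟨b, hab.symm, hbc, by grind [Sym2.eq_swap]⟩
  · exact ⟨b, hbc, hab.symm, by grind [Sym2.eq_swap]⟩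

/-- Suppose `b` has neighbours `c` and `x` in the `𝒯`-free 2-matching `A`, and `ax ∈ A` while
`ab, ac ∉ A`. Exchanging along the triangle `abx` keeps `A` free of triangles of `𝒯`. -/
lemma TFree.symmDiff_triangle [DecidableEq V] {𝒯 : Finset (Finset (Sym2 V))}
    (h𝒯 : ∀ T ∈ 𝒯, IsTriangle T) {A : Finset (Sym2 V)} (hAm : IsTwoMatching A)
    (hAf : TFree 𝒯 A) {a b c x : V} (hxa : x ≠ a) (hab : a ≠ b) (hab' : s(a, b) ∉ A)
    (hac : s(a, c) ∉ A) (hbc : s(b, c) ∈ A) (hax : s(a, x) ∈ A) (hbx : s(b, x) ∈ A) :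
    (A ∩ {s(a, b), s(a, x), s(b, x)}).card = 2 ∧
      TFree 𝒯 (symmDiff A {s(a, b), s(a, x), s(b, x)}) := by
  constructor
  · have : A ∩ {s(a, b), s(a, x), s(b, x)} = {s(a, x), s(b, x)} := by
      ext e
      simp only [Finset.mem_inter, Finset.mem_insert, Finset.mem_singleton]
      grind
    rw [this, Finset.card_pair]
    simp [hab, hxa.symm]
  · intro S hS hsub
    have hsub' : ∀ e ∈ S, e = s(a, b) ∨ e ∈ A ∧ e ≠ s(a, x) ∧ e ≠ s(b, x) := by
      intro e he
      have := hsub he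
      simp only [Finset.mem_symmDiff, Finset.mem_insert, Finset.mem_singleton] at this
      grind
    have habS : s(a, b) ∈ S := by
      by_contra h
      exact hAf S hS fun e he => by grind
    obtain ⟨y, hya, hyb, rfl⟩ := (h𝒯 S hS).exists_third habS
    have hay := hsub' s(a, y) (by simp)
    have hby := hsub' s(b, y) (by simp)
    simp only [ne_eq, Sym2.eq_iff] at hay hby
    refine hAm.not_three_neighbours hbc hbx (c := y) ?_ ?_ ?_ ?_ <;> grind

/-- Claim 10 of the paper: under the configuration of Case 5 (no triangle of
`𝒯` avoids `A₁ ∪ A₂`, and no triangle `T''` of `𝒯` has `|A₂ ∩ T''| = 2` with `A₂ Δ T''`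
`𝒯`-free), every triangle of `𝒯(T ∪ T')` has its node set contained in `{u₁, u₂, u₃, u₄}`. -/
theorem stmt8 [Fintype V] [DecidableEq V]
    (E : Finset (Sym2 V)) (w : Sym2 V → ℚ) (hw : ∀ e, 0 ≤ w e)
    (𝒯 : Finset (Finset (Sym2 V))) (h𝒯 : ∀ T'' ∈ 𝒯, IsTriangle T'' ∧ T'' ⊆ E)
    (A₁ A₂ : Finset (Sym2 V)) (hA₁E : A₁ ⊆ E) (hA₂E : A₂ ⊆ E)
    (hA₁m : IsTwoMatching A₁) (hA₂m : IsTwoMatching A₂)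
    (hA₁f : TFree 𝒯 A₁) (hA₂f : TFree 𝒯 A₂)
    (u₁ u₂ u₃ u₄ : V)
    (h12 : u₁ ≠ u₂) (h13 : u₁ ≠ u₃) (h14 : u₁ ≠ u₄)
    (h23 : u₂ ≠ u₃) (h24 : u₂ ≠ u₄) (h34 : u₃ ≠ u₄)
    (hT : ({s(u₁, u₂), s(u₂, u₃), s(u₁, u₃)} : Finset (Sym2 V)) ∈ 𝒯)
    (hT' : ({s(u₂, u₄), s(u₂, u₃), s(u₃, u₄)} : Finset (Sym2 V)) ∈ 𝒯)
    (he12 : s(u₁, u₂) ∈ A₁ \ A₂) (he13 : s(u₁, u₃) ∈ A₁ \ A₂)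
    (he24 : s(u₂, u₄) ∈ A₁ \ A₂) (he34 : s(u₃, u₄) ∈ A₁ \ A₂)
    (he23 : s(u₂, u₃) ∈ A₂ \ A₁)
    (hcase1 : ∀ T'' ∈ 𝒯, T'' ⊆ A₁ ∪ A₂)
    (hcase4 : ¬ ∃ T'' ∈ 𝒯, (A₂ ∩ T'').card = 2 ∧ TFree 𝒯 (symmDiff A₂ T'')) :
    ∀ T'' ∈ 𝒯,
      (∃ e ∈ T'', e ∈ (({s(u₁, u₂), s(u₂, u₃), s(u₁, u₃)} : Finset (Sym2 V)) ∪
        {s(u₂, u₄), s(u₂, u₃), s(u₃, u₄)})) →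
      ∀ e ∈ T'', ∀ v ∈ e, v ∈ ({u₁, u₂, u₃, u₄} : Finset V) := by
  have h𝒯' : ∀ T ∈ 𝒯, IsTriangle T := fun T hT => (h𝒯 T hT).1
  simp only [Finset.mem_sdiff] at he12 he13 he24 he34 he23
  have sw : ∀ a b : V, s(a, b) = s(b, a) := fun a b => Sym2.eq_swap
  -- All four nodes are saturated in `A₁`.
  have hsat : ∀ p ∈ ({u₁, u₂, u₃, u₄} : Finset V), ∀ x ∉ ({u₁, u₂, u₃, u₄} : Finset V),
      s(p, x) ∉ A₁ := by
    intro p hp x hx hpx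
    simp only [Finset.mem_insert, Finset.mem_singleton, not_or] at hp hx
    obtain ⟨hx1, hx2, hx3, hx4⟩ := hx
    rcases hp with rfl | rfl | rfl | rfl
    · exact hA₁m.not_three_neighbours he12.1 he13.1 hpx h23 (Ne.symm hx2) (Ne.symm hx3)
    · exact hA₁m.not_three_neighbours (sw _ _ ▸ he12.1) he24.1 hpx h14 (Ne.symm hx1) (Ne.symm hx4)
    · exact hA₁m.not_three_neighbours (sw _ _ ▸ he13.1) he34.1 hpx h14 (Ne.symm hx1) (Ne.symm hx4)
    · exact hA₁m.not_three_neighbours (sw _ _ ▸ he24.1) (sw _ _ ▸ he34.1) hpx h23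
        (Ne.symm hx2) (Ne.symm hx3)
  have key : ∀ p ∈ ({u₁, u₂, u₃, u₄} : Finset V), ∀ q ∈ ({u₁, u₂, u₃, u₄} : Finset V),
      (∀ x, x ≠ p → ({s(p, q), s(p, x), s(q, x)} : Finset (Sym2 V)) ∈ 𝒯 →
        s(p, x) ∈ A₂ → s(q, x) ∈ A₂ → False) →
      ∀ T ∈ 𝒯, s(p, q) ∈ T → ∀ e ∈ T, ∀ v ∈ e, v ∈ ({u₁, u₂, u₃, u₄} : Finset V) := by
    intro p hp q hq hpq T hTm hmem
    obtain ⟨x, hxp, hxq, rfl⟩ := (h𝒯' T hTm).exists_third hmem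
    have hx : x ∈ ({u₁, u₂, u₃, u₄} : Finset V) := by
      by_contra hx
      refine hpq x hxp hTm ?_ ?_
      · exact (Finset.mem_union.1 (hcase1 _ hTm (by simp))).resolve_left (hsat p hp x hx)
      · exact (Finset.mem_union.1 (hcase1 _ hTm (by simp))).resolve_left (hsat q hq x hx)
    intro e he v hv
    rw [Finset.mem_insert, Finset.mem_insert, Finset.mem_singleton] at he
    rcases he with rfl | rfl | rfl <;> rcases Sym2.mem_iff.1 hv with rfl | rfl <;> assumption
  have outer : ∀ a b c : V, a ≠ b → s(a, b) ∉ A₂ → s(a, c) ∉ A₂ → s(b, c) ∈ A₂ →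
      ∀ x, x ≠ a → ({s(a, b), s(a, x), s(b, x)} : Finset (Sym2 V)) ∈ 𝒯 →
        s(a, x) ∈ A₂ → s(b, x) ∈ A₂ → False :=
    fun a b c hab hab' hac hbc x hxa hTm hax hbx =>
      hcase4 ⟨_, hTm, hA₂f.symmDiff_triangle h𝒯' hA₂m hxa hab hab' hac hbc hax hbx⟩
  have h32 : s(u₃, u₂) ∈ A₂ := sw u₂ u₃ ▸ he23.1
  have h42 : s(u₄, u₂) ∉ A₂ := sw u₂ u₄ ▸ he24.2
  have h43 : s(u₄, u₃) ∉ A₂ := sw u₃ u₄ ▸ he34.2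
  rintro T hTm ⟨e, heT, he⟩
  have hcases : e = s(u₁, u₂) ∨ e = s(u₁, u₃) ∨ e = s(u₄, u₂) ∨ e = s(u₄, u₃) ∨
      e = s(u₂, u₃) := by
    rw [sw u₄ u₂, sw u₄ u₃]
    simp only [Finset.mem_union, Finset.mem_insert, Finset.mem_singleton] at he
    tauto
  rcases hcases with rfl | rfl | rfl | rfl | rfl
  · exact key _ (by simp) _ (by simp) (outer _ _ u₃ h12 he12.2 he13.2 he23.1) T hTm heT
  · exact key _ (by simp) _ (by simp) (outer _ _ u₂ h13 he13.2 he12.2 h32) T hTm heT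
  · exact key _ (by simp) _ (by simp) (outer _ _ u₃ h24.symm h42 h43 he23.1) T hTm heT
  · exact key _ (by simp) _ (by simp) (outer _ _ u₂ h34.symm h43 h42 h32) T hTm heT
  · refine key _ (by simp) _ (by simp) (fun x _ hTm hpx hqx => hA₂f _ hTm ?_) T hTm heT
    simp [Finset.insert_subset_iff, he23.1, hpx, hqx]
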